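/- arXiv:2602.12952 — 2 statements merged into one kernel-verified Lean document; each statement's English description precedes it below -/
import Mathlib

section
/- Let C ∈ ℝ^{dA×dB} admit a factorization C = U · Σ · Vᵀ, where U ∈ ℝ^{dA×dA} is orthogonal (Uᵀ · U = I_{dA}), V ∈ ℝ^{dB×dA} has orthonormal columns (Vᵀ · V = I_{dA}), and Σ ∈ ℝ^{dA×dA} is diagonal with nonnegative diagonal entries. Then for every T ∈ ℝ^{dA×dB} with orthonormal rows (T · Tᵀ = I_{dA}), trace(Tᵀ · C) ≤ trace(Σ). -/
open Matrix

/-- **Trace bound for the Procrustes problem.**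
If `C = U Σ Vᵀ` with `U` orthogonal, `V` with orthonormal columns and `Σ` diagonal
with nonnegative entries, then for every `T` with orthonormal rows,
`trace(Tᵀ C) ≤ trace Σ`. -/
theorem procrustes_trace_bound
    {dA dB : ℕ}
    (C : Matrix (Fin dA) (Fin dB) ℝ)
    (U Sig : Matrix (Fin dA) (Fin dA) ℝ)
    (V : Matrix (Fin dB) (Fin dA) ℝ)
    (hC : C = U * Sig * Vᵀ)
    (hU : Uᵀ * U = 1)
    (hV : Vᵀ * V = 1)
    (hSig_diag : Sig.IsDiag)
    (hSig_nonneg : ∀ i, 0 ≤ Sig i i) :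
    ∀ T : Matrix (Fin dA) (Fin dB) ℝ, T * Tᵀ = 1 →
      (Tᵀ * C).trace ≤ Sig.trace := by
  intro T hT
  set P : Matrix (Fin dB) (Fin dA) ℝ := Tᵀ * U with hP
  have hPP : Pᵀ * P = 1 := by
    rw [hP, Matrix.transpose_mul, Matrix.transpose_transpose, Matrix.mul_assoc,
      ← Matrix.mul_assoc T, hT, Matrix.one_mul, hU]
  have hW : ∀ i, (Vᵀ * P) i i ≤ 1 := by
    intro i
    have h1 : ∑ k, V k i * V k i = 1 := by
      have h := congrFun (congrFun hV i) i
      simpa [Matrix.mul_apply] using h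
    have h2 : ∑ k, P k i * P k i = 1 := by
      have h := congrFun (congrFun hPP i) i
      rw [Matrix.mul_apply] at h
      simpa only [Matrix.transpose_apply, Matrix.one_apply_eq] using h
    have h3 : ∑ k, 2 * (V k i * P k i) ≤ ∑ k, (V k i * V k i + P k i * P k i) :=
      Finset.sum_le_sum fun k _ => by nlinarith [sq_nonneg (V k i - P k i)]
    rw [Finset.sum_add_distrib, h1, h2, ← Finset.mul_sum] at h3
    rw [Matrix.mul_apply]
    simp only [Matrix.transpose_apply]
    linarith
  have e : (Tᵀ * C).trace = ((Vᵀ * P) * Sig).trace := by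
    rw [hC, ← Matrix.mul_assoc, ← Matrix.mul_assoc, ← hP, Matrix.trace_mul_comm,
      ← Matrix.mul_assoc]
  rw [e, Matrix.trace, Matrix.trace]
  refine Finset.sum_le_sum fun i _ => ?_
  have h4 : ((Vᵀ * P) * Sig) i i = (Vᵀ * P) i i * Sig i i := by
    rw [Matrix.mul_apply]
    refine Finset.sum_eq_single i (fun j _ hj => ?_) (fun h => absurd (Finset.mem_univ i) h)
    rw [hSig_diag hj, mul_zero]
  rw [Matrix.diag_apply, Matrix.diag_apply, h4]
  exact mul_le_of_le_one_left (hSig_nonneg i) (hW i)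
end

section
/- (Closed-form solution of the orthogonal Procrustes problem.) Let H_A ∈ ℝ^{M×dA} and H_B ∈ ℝ^{M×dB}, and suppose the cross-covariance C = H_Aᵀ · H_B admits a factorization C = U · Σ · Vᵀ with U ∈ ℝ^{dA×dA} orthogonal (Uᵀ · U = I_{dA} and U · Uᵀ = I_{dA}), V ∈ ℝ^{dB×dA} with orthonormal columns (Vᵀ · V = I_{dA}), and Σ ∈ ℝ^{dA×dA} diagonal with nonnegative diagonal entries. Then T* = U · Vᵀ satisfies T* · T*ᵀ = I_{dA}, and for every T ∈ ℝ^{dA×dB} with T · Tᵀ = I_{dA}, ‖H_A · T* − H_B‖_F ≤ ‖H_A · T − H_B‖_F. -/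
open Matrix

/-- The Frobenius norm of a real matrix: `‖X‖_F = sqrt (Σ_{i,j} X_{i,j}²)`. -/
noncomputable def frobNorm {α β : Type*} [Fintype α] [Fintype β]
    (X : Matrix α β ℝ) : ℝ :=
  Real.sqrt (∑ i, ∑ j, (X i j) ^ 2)

lemma frob_sq_eq {m n : ℕ} (X : Matrix (Fin m) (Fin n) ℝ) :
    ∑ i, ∑ j, (X i j) ^ 2 = trace (Xᵀ * X) := by
  simp only [trace, diag_apply, mul_apply, transpose_apply]
  rw [Finset.sum_comm]
  simp only [sq]

lemma frob_expand {m a b : ℕ} (A : Matrix (Fin m) (Fin a) ℝ) (B : Matrix (Fin m) (Fin b) ℝ)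
    (T : Matrix (Fin a) (Fin b) ℝ) (hT : T * Tᵀ = 1) :
    trace ((A * T - B)ᵀ * (A * T - B))
      = trace (Aᵀ * A) - 2 * trace (Tᵀ * (Aᵀ * B)) + trace (Bᵀ * B) := by
  have h1 : trace ((A * T)ᵀ * (A * T)) = trace (Aᵀ * A) := by
    rw [transpose_mul, Matrix.mul_assoc, trace_mul_comm]
    rw [Matrix.mul_assoc, Matrix.mul_assoc, hT, Matrix.mul_one]
  have h2 : trace ((A * T)ᵀ * B) = trace (Tᵀ * (Aᵀ * B)) := by
    rw [transpose_mul, Matrix.mul_assoc]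
  have h3 : trace (Bᵀ * (A * T)) = trace (Tᵀ * (Aᵀ * B)) := by
    rw [← h2, ← trace_transpose, transpose_mul, transpose_transpose]
  rw [transpose_sub, Matrix.sub_mul, Matrix.mul_sub, Matrix.mul_sub, trace_sub, trace_sub,
    trace_sub, h1, h2, h3]
  ring

lemma diag_le_one {a b : ℕ} (V W : Matrix (Fin b) (Fin a) ℝ) (hV : Vᵀ * V = 1)
    (hW : Wᵀ * W = 1) (i : Fin a) : (Vᵀ * W) i i ≤ 1 := by
  have h1 := congrFun (congrFun hV i) i
  have h2 := congrFun (congrFun hW i) i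
  simp only [mul_apply, transpose_apply, one_apply_eq] at h1 h2 ⊢
  have h : ∑ k, V k i * W k i ≤ ∑ k, (V k i * V k i + W k i * W k i) / 2 :=
    Finset.sum_le_sum fun k _ => by nlinarith [sq_nonneg (V k i - W k i)]
  rw [← Finset.sum_div, Finset.sum_add_distrib, h1, h2] at h
  linarith

lemma trace_cross {a b : ℕ} (U S : Matrix (Fin a) (Fin a) ℝ) (V : Matrix (Fin b) (Fin a) ℝ)
    (T : Matrix (Fin a) (Fin b) ℝ) (hS : S.IsDiag) :
    trace (Tᵀ * (U * S * Vᵀ)) = ∑ i, S i i * (Vᵀ * (Tᵀ * U)) i i := by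
  have : trace (Tᵀ * (U * S * Vᵀ)) = trace (S * (Vᵀ * (Tᵀ * U))) := by
    rw [← Matrix.mul_assoc, ← Matrix.mul_assoc, Matrix.mul_assoc, trace_mul_comm,
      Matrix.mul_assoc]
  rw [this, ← hS.diagonal_diag]
  simp [trace, diagonal_mul]

/-- **Closed-form solution of the orthogonal Procrustes problem.**
If the cross-covariance `C = H_Aᵀ H_B` factors as `C = U Σ Vᵀ` with `U` orthogonal,
`V` with orthonormal columns and `Σ` diagonal with nonnegative entries, then
`T* = U Vᵀ` has orthonormal rows and minimizes `‖H_A T − H_B‖_F` over all `T`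
with orthonormal rows. -/
theorem procrustes_closed_form
    {M dA dB : ℕ}
    (H_A : Matrix (Fin M) (Fin dA) ℝ)
    (H_B : Matrix (Fin M) (Fin dB) ℝ)
    (U Sig : Matrix (Fin dA) (Fin dA) ℝ)
    (V : Matrix (Fin dB) (Fin dA) ℝ)
    (hC : H_Aᵀ * H_B = U * Sig * Vᵀ)
    (hU : Uᵀ * U = 1) (hU' : U * Uᵀ = 1)
    (hV : Vᵀ * V = 1)
    (hSig_diag : Sig.IsDiag)
    (hSig_nonneg : ∀ i, 0 ≤ Sig i i) :
    (U * Vᵀ) * (U * Vᵀ)ᵀ = 1 ∧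
    ∀ T : Matrix (Fin dA) (Fin dB) ℝ, T * Tᵀ = 1 →
      frobNorm (H_A * (U * Vᵀ) - H_B) ≤ frobNorm (H_A * T - H_B) := by
  have hstar : (U * Vᵀ) * (U * Vᵀ)ᵀ = 1 := by
    rw [transpose_mul, transpose_transpose, Matrix.mul_assoc, ← Matrix.mul_assoc Vᵀ, hV,
      Matrix.one_mul, hU']
  refine ⟨hstar, fun T hT => ?_⟩
  unfold frobNorm
  apply Real.sqrt_le_sqrt
  rw [frob_sq_eq, frob_sq_eq, frob_expand _ _ _ hstar, frob_expand _ _ _ hT, hC,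
    trace_cross _ _ _ _ hSig_diag, trace_cross _ _ _ _ hSig_diag]
  have hZ : Vᵀ * ((U * Vᵀ)ᵀ * U) = 1 := by
    rw [transpose_mul, transpose_transpose, Matrix.mul_assoc, hU, Matrix.mul_one, hV]
  have hW : (Tᵀ * U)ᵀ * (Tᵀ * U) = 1 := by
    rw [transpose_mul, transpose_transpose, Matrix.mul_assoc, ← Matrix.mul_assoc T, hT,
      Matrix.one_mul, hU]
  have h : ∑ i, Sig i i * (Vᵀ * (Tᵀ * U)) i i ≤ ∑ i, Sig i i * (Vᵀ * ((U * Vᵀ)ᵀ * U)) i i := by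
    rw [hZ]
    refine Finset.sum_le_sum fun i _ => mul_le_mul_of_nonneg_left ?_ (hSig_nonneg i)
    rw [one_apply_eq]
    exact diag_le_one V (Tᵀ * U) hV hW i
  linarith
end
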